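/- Radial capacity is nonnegative and monotone: let K be a compact subset of closure(𝕌) such that 0 ∈ 𝕌 \ K and 𝕌 \ K is simply connected, and let g_K be the unique conformal map from 𝕌 \ K onto 𝕌 with g_K(0) = 0 and g_K'(0) > 0. Then a(K) := log g_K'(0) ≥ 0, and if K ⊂ K' are two such compact sets then a(K) ≤ a(K'). -/

import Mathlib

open Complex Set Filter
open scoped Topology

noncomputable section

/-- The open unit disc `𝕌`. -/
def UD : Set ℂ := Metric.ball (0:ℂ) 1

/-- A radial hull: a compact subset `K` of `closure 𝕌` with `0 ∈ 𝕌 \ K` and `𝕌 \ K`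
simply connected. -/
structure IsRadialHull (K : Set ℂ) : Prop where
  compact : IsCompact K
  subset : K ⊆ closure UD
  zero_not_mem : (0:ℂ) ∉ K
  simplyConnected : SimplyConnectedSpace ↥(UD \ K)

/-- `g` is the conformal map from `𝕌 \ K` onto `𝕌` normalized at the origin:
`g(0) = 0` and `g'(0) > 0` (a positive real). -/
structure IsRadialNormalizedMap (K : Set ℂ) (g : ℂ → ℂ) : Prop where
  holo : DifferentiableOn ℂ g (UD \ K)
  inj : InjOn g (UD \ K)
  onto : g '' (UD \ K) = UD
  zero : g 0 = 0
  deriv0_real : (deriv g 0).im = 0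
  deriv0_pos : 0 < (deriv g 0).re

/-! ### Inverses of injective holomorphic functions -/

/-- An injective holomorphic function on an open set is open at every point. -/
theorem nhds_le_map_nhds_of_injOn {U : Set ℂ} {g : ℂ → ℂ} (hU : IsOpen U)
    (hg : DifferentiableOn ℂ g U) (hinj : InjOn g U) {z : ℂ} (hz : z ∈ U) :
    𝓝 (g z) ≤ map g (𝓝 z) := by
  refine (hg.analyticAt (hU.mem_nhds hz)).eventually_constant_or_nhds_le_map_nhds.resolve_left
    fun h => ?_
  have hcst : ∀ᶠ w in 𝓝[≠] z, False := by
    filter_upwards [h.filter_mono nhdsWithin_le_nhds, self_mem_nhdsWithin,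
      mem_nhdsWithin_of_mem_nhds (hU.mem_nhds hz)] with w hw hne hwU
    exact hne (hinj hwU hz hw)
  exact hcst.exists.elim fun _ h => h

/-- The zeros of the derivative of an injective holomorphic function are isolated. -/
theorem eventually_deriv_ne_zero_of_injOn {U : Set ℂ} {g : ℂ → ℂ} (hU : IsOpen U)
    (hg : DifferentiableOn ℂ g U) (hinj : InjOn g U) {z : ℂ} (hz : z ∈ U) :
    ∀ᶠ w in 𝓝[≠] z, deriv g w ≠ 0 := by
  have hga : AnalyticAt ℂ (deriv g) z := (hg.analyticAt (hU.mem_nhds hz)).deriv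
  refine hga.eventually_eq_zero_or_eventually_ne_zero.resolve_left fun h => ?_
  obtain ⟨r, hr, hball⟩ := Metric.eventually_nhds_iff_ball.1 (h.and (hU.mem_nhds hz))
  obtain ⟨a, ha⟩ := Metric.isOpen_ball.exists_is_const_of_deriv_eq_zero
    (convex_ball z r).isPreconnected (hg.mono fun w hw => (hball w hw).2)
    (fun w hw => (hball w hw).1)
  have hcst : ∀ᶠ w in 𝓝[≠] z, False := by
    filter_upwards [self_mem_nhdsWithin,
      mem_nhdsWithin_of_mem_nhds (Metric.ball_mem_nhds z hr)] with w hne hw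
    exact hne (hinj (hball w hw).2 hz
      ((ha w hw).trans (ha z (Metric.mem_ball_self hr)).symm))
  exact hcst.exists.elim fun _ h => h

/-- The inverse of an injective holomorphic function is holomorphic. -/
theorem differentiableOn_invFunOn {U : Set ℂ} {g : ℂ → ℂ} (hU : IsOpen U)
    (hg : DifferentiableOn ℂ g U) (hinj : InjOn g U) :
    DifferentiableOn ℂ (Function.invFunOn g U) (g '' U) := by
  set e := Function.invFunOn g U
  have hleft : ∀ z ∈ U, e (g z) = z := fun z hz => hinj.leftInvOn_invFunOn hz
  have himg : ∀ z ∈ U, g '' U ∈ 𝓝 (g z) := fun z hz =>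
    nhds_le_map_nhds_of_injOn hU hg hinj hz (image_mem_map (hU.mem_nhds hz))
  have hcont : ∀ z ∈ U, ContinuousAt e (g z) := by
    intro z hz
    rw [ContinuousAt, hleft z hz]
    refine (tendsto_map'_iff.2 ?_).mono_left (nhds_le_map_nhds_of_injOn hU hg hinj hz)
    refine tendsto_id.congr' ?_
    filter_upwards [hU.mem_nhds hz] with w hw using (hleft w hw).symm
  have hdiff : ∀ z ∈ U, deriv g z ≠ 0 → DifferentiableAt ℂ e (g z) := by
    intro z hz hd
    refine (HasDerivAt.of_local_left_inverse (f := g) (f' := deriv g z) (hcont z hz) ?_ hd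
      ?_).differentiableAt
    · rw [hleft z hz]
      exact (hg.differentiableAt (hU.mem_nhds hz)).hasDerivAt
    · filter_upwards [himg z hz] with y hy using Function.invFunOn_eq hy
  rintro _ ⟨z, hz, rfl⟩
  obtain ⟨V, hV, hVo, hzV⟩ := eventually_nhds_iff.1
    ((eventually_nhdsWithin_iff.1 (eventually_deriv_ne_zero_of_injOn hU hg hinj hz)).and
      (hU.mem_nhds hz))
  have hnhds : g '' V ∈ 𝓝 (g z) :=
    nhds_le_map_nhds_of_injOn hU hg hinj hz (image_mem_map (hVo.mem_nhds hzV))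
  refine (DifferentiableOn.differentiableAt ?_ hnhds).differentiableWithinAt
  refine (differentiableOn_compl_singleton_and_continuousAt_iff hnhds).1 ⟨?_, hcont z hz⟩
  rintro _ ⟨⟨w, hw, rfl⟩, hne⟩
  refine (hdiff w (hV w hw).2 ((hV w hw).1 fun h => hne ?_)).differentiableWithinAt
  rw [mem_singleton_iff.1 h]
  rfl

/-! ### The Schwarz lemma for conformal maps onto the disc -/

section Schwarz

variable {U : Set ℂ} {f g : ℂ → ℂ}

theorem schwarz_comp_invFunOn (hU : IsOpen U) (h0 : (0 : ℂ) ∈ U)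
    (hg : DifferentiableOn ℂ g U) (hinj : InjOn g U) (honto : g '' U = Metric.ball 0 1)
    (hg0 : g 0 = 0) (hf : DifferentiableOn ℂ f U) (hmaps : MapsTo f U (Metric.ball 0 1))
    (hf0 : f 0 = 0) :
    ∃ φ : ℂ → ℂ, DifferentiableOn ℂ φ (Metric.ball 0 1) ∧
      MapsTo φ (Metric.ball 0 1) (Metric.ball 0 1) ∧ φ 0 = 0 ∧ EqOn f (φ ∘ g) U ∧
      deriv f 0 = deriv φ 0 * deriv g 0 := by
  have he : DifferentiableOn ℂ (Function.invFunOn g U) (Metric.ball 0 1) :=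
    honto ▸ differentiableOn_invFunOn hU hg hinj
  have hleft : ∀ z ∈ U, Function.invFunOn g U (g z) = z := fun z hz =>
    hinj.leftInvOn_invFunOn hz
  have hmem : MapsTo (Function.invFunOn g U) (Metric.ball 0 1) U := fun w hw =>
    Function.invFunOn_mem (honto.symm.subset hw)
  have hφ : DifferentiableOn ℂ (f ∘ Function.invFunOn g U) (Metric.ball 0 1) :=
    hf.comp he hmem
  have heq : EqOn f ((f ∘ Function.invFunOn g U) ∘ g) U := fun z hz => by
    simp [hleft z hz]
  refine ⟨f ∘ Function.invFunOn g U, hφ, hmaps.comp hmem, ?_, heq, ?_⟩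
  · have := heq h0
    rw [Function.comp_apply, hg0, hf0] at this
    exact this.symm
  · rw [(heq.eventuallyEq_of_mem (hU.mem_nhds h0)).deriv_eq, deriv_comp, hg0]
    · rw [hg0]
      exact hφ.differentiableAt (Metric.ball_mem_nhds 0 one_pos)
    · exact hg.differentiableAt (hU.mem_nhds h0)

/-- Among holomorphic maps into the disc fixing `0`, a conformal map onto the disc has the
largest derivative at `0`. -/
theorem norm_deriv_le_norm_deriv (hU : IsOpen U) (h0 : (0 : ℂ) ∈ U)
    (hg : DifferentiableOn ℂ g U) (hinj : InjOn g U) (honto : g '' U = Metric.ball 0 1)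
    (hg0 : g 0 = 0) (hf : DifferentiableOn ℂ f U) (hmaps : MapsTo f U (Metric.ball 0 1))
    (hf0 : f 0 = 0) : ‖deriv f 0‖ ≤ ‖deriv g 0‖ := by
  obtain ⟨φ, hφ, hφm, hφ0, -, hd⟩ :=
    schwarz_comp_invFunOn hU h0 hg hinj honto hg0 hf hmaps hf0
  have hle : ‖deriv φ 0‖ ≤ 1 := norm_deriv_le_one_of_mapsTo_ball hφ
    (hφ0.symm ▸ hφm.mono_right Metric.ball_subset_closedBall) one_pos
  rw [hd, norm_mul]
  exact mul_le_of_le_one_left (norm_nonneg _) hle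

/-- A holomorphic map into the disc fixing `0` which has the same nonzero derivative at `0` as a
conformal map onto the disc agrees with it. -/
theorem eqOn_of_deriv_eq (hU : IsOpen U) (h0 : (0 : ℂ) ∈ U)
    (hg : DifferentiableOn ℂ g U) (hinj : InjOn g U) (honto : g '' U = Metric.ball 0 1)
    (hg0 : g 0 = 0) (hf : DifferentiableOn ℂ f U) (hmaps : MapsTo f U (Metric.ball 0 1))
    (hf0 : f 0 = 0) (hd : deriv f 0 = deriv g 0) (hd0 : deriv g 0 ≠ 0) : EqOn f g U := by
  obtain ⟨φ, hφ, hφm, hφ0, heq, hdφ⟩ :=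
    schwarz_comp_invFunOn hU h0 hg hinj honto hg0 hf hmaps hf0
  have hone : deriv φ 0 = 1 := by
    rw [hd] at hdφ
    exact (mul_eq_right₀ hd0).1 hdφ.symm
  have haff := affine_of_mapsTo_ball_of_norm_dslope_eq_div (R₂ := 1) hφ
    (by rw [hφ0]; exact hφm.mono_right Metric.ball_subset_closedBall)
    (Metric.mem_ball_self one_pos) (by simp [hone])
  intro z hz
  rw [heq hz, Function.comp_apply, haff (honto ▸ mem_image_of_mem g hz)]
  simp [hφ0, hone]

end Schwarz

/-! ### Normal families and Hurwitz's theorem -/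

/-- A weak form of **Montel's theorem**: along an ultrafilter, holomorphic functions with values in
the unit disc converge locally uniformly. -/
theorem exists_tendstoLocallyUniformlyOn_of_mapsTo_ball {ι : Type*} (l : Ultrafilter ι)
    {U : Set ℂ} (hU : IsOpen U) {F : ι → ℂ → ℂ} (hF : ∀ i, DifferentiableOn ℂ (F i) U)
    (hmaps : ∀ i, MapsTo (F i) U (Metric.ball 0 1)) :
    ∃ f : ℂ → ℂ, MapsTo f U (Metric.closedBall 0 1) ∧ TendstoLocallyUniformlyOn F f l U := by
  have hlim : ∀ z ∈ U, ∃ w ∈ Metric.closedBall (0 : ℂ) 1, Tendsto (F · z) l (𝓝 w) := fun z hz =>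
    (isCompact_closedBall (0 : ℂ) 1).ultrafilter_le_nhds' (l.map (F · z))
      (Filter.mem_map.2 (univ_mem' fun i => Metric.ball_subset_closedBall (hmaps i hz)))
  choose! f hfm hf using hlim
  refine ⟨f, hfm, Metric.tendstoLocallyUniformlyOn_iff.2 fun ε hε x hx => ?_⟩
  obtain ⟨r, hr, hball⟩ := Metric.isOpen_iff.1 hU x hx
  have hequi : ∀ i, ∀ z ∈ Metric.ball x r, dist (F i z) (F i x) ≤ 2 / r * dist z x := by
    intro i z hz
    refine dist_le_div_mul_dist_of_mapsTo_ball ((hF i).mono hball) (fun w hw => ?_) hz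
    have hw' := mem_ball_zero_iff.1 (hmaps i (hball hw))
    have hx' := mem_ball_zero_iff.1 (hmaps i hx)
    rw [mem_closedBall_iff_norm]
    linarith [norm_sub_le (F i w) (F i x)]
  have hequi' : ∀ z ∈ Metric.ball x r, dist (f z) (f x) ≤ 2 / r * dist z x := fun z hz =>
    le_of_tendsto ((hf z (hball hz)).dist (hf x hx)) (univ_mem' fun i => hequi i z hz)
  have hsmall : ∀ᶠ z in 𝓝 x, 2 / r * dist z x < ε / 3 := by
    have : Tendsto (fun z => 2 / r * dist z x) (𝓝 x) (𝓝 (2 / r * dist x x)) :=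
      (by fun_prop : Continuous fun z => 2 / r * dist z x).tendsto x
    rw [dist_self, mul_zero] at this
    exact this.eventually_lt_const (by positivity)
  refine ⟨_, mem_nhdsWithin_of_mem_nhds (inter_mem (Metric.ball_mem_nhds x hr) hsmall), ?_⟩
  filter_upwards [Metric.tendsto_nhds.1 (hf x hx) (ε / 3) (by positivity)] with i hi z hz
  have h1 := hequi i z hz.1
  have h2 := hequi' z hz.1
  have h3 : 2 / r * dist z x < ε / 3 := hz.2
  have h4 := dist_triangle4_right (f z) (F i z) (f x) (F i x)
  rw [dist_comm] at hi
  linarith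

/-- **Hurwitz's theorem**: a nonconstant locally uniform limit of injective holomorphic functions
on a connected open set is injective. -/
theorem injOn_of_tendstoLocallyUniformlyOn {ι : Type*} {l : Filter ι} [l.NeBot]
    {U : Set ℂ} (hU : IsOpen U) (hUc : IsPreconnected U) {F : ι → ℂ → ℂ} {f : ℂ → ℂ}
    (hF : ∀ i, DifferentiableOn ℂ (F i) U) (hinj : ∀ i, InjOn (F i) U)
    (hlim : TendstoLocallyUniformlyOn F f l U) (hf : ∀ c, ¬ EqOn f (fun _ => c) U) :
    InjOn f U := by
  intro a ha b hb hab
  by_contra hne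
  have hfd : DifferentiableOn ℂ f U := hlim.differentiableOn (.of_forall hF) hU
  have hfa : AnalyticOnNhd ℂ f U := hfd.analyticOnNhd hU
  have hiso : ∀ᶠ z in 𝓝[≠] b, f z ≠ f b :=
    ((hfa b hb).eventually_eq_or_eventually_ne analyticAt_const).resolve_left fun h =>
      hf (f b) (hfa.eqOn_of_preconnected_of_eventuallyEq analyticOnNhd_const hUc hb h)
  have hnear : ∀ᶠ z in 𝓝 b, (z ≠ b → f z ≠ f b) ∧ z ∈ U ∧ z ≠ a :=
    (eventually_nhdsWithin_iff.1 hiso).and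
      ((hU.eventually_mem hb).and (isOpen_ne.mem_nhds (Ne.symm hne)))
  obtain ⟨r, hr, hball⟩ := Metric.nhds_basis_closedBall.eventually_iff.1 hnear
  have hsub : Metric.closedBall b r ⊆ U := fun z hz => (hball hz).2.1
  obtain ⟨m, hm, hmin⟩ : ∃ m > 0, ∀ z ∈ Metric.sphere b r, m ≤ ‖f z - f b‖ := by
    obtain ⟨z₀, hz₀, hz₀min⟩ := (isCompact_sphere b r).exists_isMinOn
      (NormedSpace.sphere_nonempty.2 hr.le)
      ((hfd.continuousOn.mono (Metric.sphere_subset_closedBall.trans hsub)).sub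
        continuousOn_const).norm
    refine ⟨_, norm_pos_iff.2 (sub_ne_zero.2 ((hball (Metric.sphere_subset_closedBall hz₀)).1 ?_)),
      fun z hz => hz₀min hz⟩
    exact Metric.ne_of_mem_sphere hz₀ hr.ne'
  have hunif : TendstoUniformlyOn F f l (Metric.closedBall b r) :=
    (tendstoLocallyUniformlyOn_iff_forall_isCompact hU).1 hlim _ hsub (isCompact_closedBall b r)
  obtain ⟨i, hi, hia⟩ := ((Metric.tendstoUniformlyOn_iff.1 hunif (m / 8) (by positivity)).and
    (Metric.tendsto_nhds.1 (hlim.tendsto_at ha) (m / 8) (by positivity))).exists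
  have hib := hi b (Metric.mem_closedBall_self hr.le)
  have hcover := DiffContOnCl.ball_subset_image_closedBall (f := F i) (z₀ := b) (r := r)
    (ε := m / 2) (((hF i).mono hsub).diffContOnCl_ball subset_rfl) hr (fun z hz => ?_) ?_
  · have hmem : F i a ∈ Metric.ball (F i b) (m / 2 / 2) := by
      rw [Metric.mem_ball]
      rw [hab] at hia
      linarith [dist_triangle (F i a) (f b) (F i b)]
    obtain ⟨z, hz, hza⟩ := hcover hmem
    exact (hball hz).2.2 (hinj i (hsub hz) ha hza)
  · have h1 := hi z (Metric.sphere_subset_closedBall hz)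
    have h2 := hmin z hz
    rw [← dist_eq_norm] at h2 ⊢
    have h3 := dist_triangle4 (f z) (F i z) (F i b) (f b)
    rw [dist_comm] at hib
    linarith
  · have : ∀ᶠ z in 𝓝[≠] b, F i z ≠ F i b := by
      filter_upwards [self_mem_nhdsWithin,
        mem_nhdsWithin_of_mem_nhds (hU.mem_nhds hb)] with z hzb hz heq
      exact hzb (hinj i hz hb heq)
    exact this.frequently.filter_mono nhdsWithin_le_nhds

/-! ### Disc automorphisms and square roots -/

open scoped ComplexConjugate

/-- The automorphism of the unit disc which sends `w` to `0`. -/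
def discMobius (w z : ℂ) : ℂ := (z - w) / (1 - conj w * z)

section DiscMobius

variable {w z : ℂ}

theorem one_sub_conj_mul_ne_zero (hw : ‖w‖ < 1) (hz : ‖z‖ < 1) : 1 - conj w * z ≠ 0 := by
  intro h
  have h1 : ‖conj w * z‖ = 1 := by rw [← sub_eq_zero.1 h, norm_one]
  rw [norm_mul, norm_conj] at h1
  nlinarith [norm_nonneg w, norm_nonneg z]

theorem hasDerivAt_discMobius (hw : ‖w‖ < 1) (hz : ‖z‖ < 1) :
    HasDerivAt (discMobius w) ((1 - conj w * w) / (1 - conj w * z) ^ 2) z := by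
  have h := ((hasDerivAt_id z).sub_const w).div
    (((hasDerivAt_id z).const_mul (conj w)).const_sub 1) (one_sub_conj_mul_ne_zero hw hz)
  refine h.congr_deriv ?_
  simp only [id]
  ring

theorem norm_discMobius_lt_one (hw : ‖w‖ < 1) (hz : ‖z‖ < 1) : ‖discMobius w z‖ < 1 := by
  rw [discMobius, norm_div, div_lt_one (norm_pos_iff.2 (one_sub_conj_mul_ne_zero hw hz))]
  refine lt_of_pow_lt_pow_left₀ 2 (norm_nonneg _) ?_
  have hw2 : normSq w < 1 := by rw [normSq_eq_norm_sq]; nlinarith [norm_nonneg w]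
  have hz2 : normSq z < 1 := by rw [normSq_eq_norm_sq]; nlinarith [norm_nonneg z]
  rw [← normSq_eq_norm_sq, ← normSq_eq_norm_sq]
  have key : normSq (1 - conj w * z) - normSq (z - w) = (1 - normSq w) * (1 - normSq z) := by
    simp only [normSq_apply, sub_re, sub_im, mul_re, mul_im, conj_re, conj_im, one_re, one_im]
    ring
  nlinarith [mul_pos (sub_pos.2 hw2) (sub_pos.2 hz2)]

theorem discMobius_self : discMobius w w = 0 := by simp [discMobius]

theorem discMobius_ne_zero (hw : ‖w‖ < 1) (hz : ‖z‖ < 1) (h : z ≠ w) : discMobius w z ≠ 0 :=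
  div_ne_zero (sub_ne_zero.2 h) (one_sub_conj_mul_ne_zero hw hz)

theorem injOn_discMobius (hw : ‖w‖ < 1) : InjOn (discMobius w) (Metric.ball 0 1) := by
  intro x hx y hy h
  rw [mem_ball_zero_iff] at hx hy
  rw [discMobius, discMobius, div_eq_div_iff (one_sub_conj_mul_ne_zero hw hx)
    (one_sub_conj_mul_ne_zero hw hy)] at h
  have : (x - y) * (1 - conj w * w) = 0 := by linear_combination h
  exact sub_eq_zero.1 ((mul_eq_zero.1 this).resolve_right (one_sub_conj_mul_ne_zero hw hw))

end DiscMobius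

/-- A continuous square root of a differentiable function is differentiable away from its zeros. -/
theorem hasDerivAt_of_sq_eq {q g : ℂ → ℂ} {g' z : ℂ} (hq : ContinuousAt q z)
    (hsq : ∀ x, q x ^ 2 = g x) (hg : HasDerivAt g g' z) (hz : q z ≠ 0) :
    HasDerivAt q (g' / (2 * q z)) z := by
  rw [hasDerivAt_iff_tendsto_slope] at hg ⊢
  have hsum : Tendsto (fun x => q x + q z) (𝓝[≠] z) (𝓝 (2 * q z)) := by
    rw [two_mul]
    exact (hq.tendsto.mono_left nhdsWithin_le_nhds).add_const _
  have h2 : 2 * q z ≠ 0 := mul_ne_zero two_ne_zero hz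
  refine (hg.div hsum h2).congr' ?_
  filter_upwards [hsum.eventually_ne h2] with x hx
  rw [Pi.div_apply, slope_def_field, slope_def_field, ← hsq, ← hsq, div_eq_iff hx]
  ring

/-! ### The Riemann mapping theorem -/

/-- An injective holomorphic map into the disc which omits a value of the disc does not have the
largest possible derivative at `0`. -/
theorem exists_norm_deriv_lt {U : Set ℂ} (hU : IsOpen U) (hUc : IsSimplyConnected U)
    (h0 : (0 : ℂ) ∈ U) {f : ℂ → ℂ} (hf : DifferentiableOn ℂ f U)
    (hmaps : MapsTo f U (Metric.ball 0 1)) (hinj : InjOn f U) (hf0 : f 0 = 0)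
    (hd : deriv f 0 ≠ 0) {w : ℂ} (hw : ‖w‖ < 1) (hwf : w ∉ f '' U) :
    ∃ F : ℂ → ℂ, DifferentiableOn ℂ F U ∧ MapsTo F U (Metric.ball 0 1) ∧ InjOn F U ∧
      F 0 = 0 ∧ ‖deriv f 0‖ < ‖deriv F 0‖ := by
  have hfz : ∀ z ∈ U, ‖f z‖ < 1 := fun z hz => mem_ball_zero_iff.1 (hmaps hz)
  have hg : ∀ z ∈ U, HasDerivAt (discMobius w ∘ f)
      ((1 - conj w * w) / (1 - conj w * f z) ^ 2 * deriv f z) z := fun z hz =>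
    (hasDerivAt_discMobius hw (hfz z hz)).comp z
      (hf.differentiableAt (hU.mem_nhds hz)).hasDerivAt
  have hgne : ∀ z ∈ U, (discMobius w ∘ f) z ≠ 0 := fun z hz =>
    discMobius_ne_zero hw (hfz z hz) fun h => hwf ⟨z, hz, h⟩
  obtain ⟨q, hqc, hq⟩ := exists_continuousOn_pow_eq hUc hU
    (fun z hz => (hg z hz).continuousAt.continuousWithinAt)
    (by rintro ⟨z, hz, h⟩; exact hgne z hz h) two_ne_zero
  have hqne : ∀ z ∈ U, q z ≠ 0 := fun z hz h => hgne z hz (by rw [← hq, h]; simp)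
  have hqd := fun z hz =>
    hasDerivAt_of_sq_eq (hqc.continuousAt (hU.mem_nhds hz)) hq (hg z hz) (hqne z hz)
  have hqlt : ∀ z ∈ U, ‖q z‖ < 1 := by
    intro z hz
    have h := norm_discMobius_lt_one hw (hfz z hz)
    rw [← Function.comp_apply (f := discMobius w), ← hq, norm_pow] at h
    exact (sq_lt_one_iff₀ (norm_nonneg _)).1 h
  have hqinj : InjOn q U := by
    intro x hx y hy h
    refine hinj hx hy (injOn_discMobius hw (hmaps hx) (hmaps hy) ?_)
    have := congrArg (· ^ 2) h
    simpa [hq] using this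
  have hFd := fun z hz => (hasDerivAt_discMobius (hqlt 0 h0) (hqlt z hz)).comp z (hqd z hz)
  refine ⟨discMobius (q 0) ∘ q, fun z hz => (hFd z hz).differentiableAt.differentiableWithinAt,
    fun z hz => mem_ball_zero_iff.2 (norm_discMobius_lt_one (hqlt 0 h0) (hqlt z hz)),
    (injOn_discMobius (hqlt 0 h0)).comp hqinj fun z hz => mem_ball_zero_iff.2 (hqlt z hz),
    discMobius_self, ?_⟩
  have hsq : ‖q 0‖ ^ 2 = ‖w‖ := by
    rw [← norm_pow, hq]
    simp [discMobius, hf0]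
  have hnorm : ∀ b : ℂ, ‖b‖ < 1 → ‖1 - conj b * b‖ = 1 - ‖b‖ ^ 2 := by
    intro b hb
    rw [← normSq_eq_conj_mul_self, normSq_eq_norm_sq, ← ofReal_one, ← ofReal_sub, norm_real,
      Real.norm_of_nonneg]
    nlinarith [norm_nonneg b]
  have hlt := hqlt 0 h0
  have hpos : 0 < ‖q 0‖ := norm_pos_iff.2 (hqne 0 h0)
  rw [(hFd 0 h0).deriv, hf0]
  simp only [mul_zero, sub_zero, one_pow, div_one, norm_mul, norm_div, norm_pow, norm_ofNat,
    hnorm _ hw, hnorm _ hlt, ← hsq]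
  have hd' := norm_pos_iff.2 hd
  generalize ‖q 0‖ = t at *
  have h1 : 0 < 1 - t ^ 2 := by nlinarith
  have : (1 - t ^ 2) / (1 - t ^ 2) ^ 2 * ((1 - (t ^ 2) ^ 2) * ‖deriv f 0‖ / (2 * t)) =
      (1 + t ^ 2) / (2 * t) * ‖deriv f 0‖ := by
    field_simp
    ring
  rw [this]
  refine lt_mul_of_one_lt_left hd' ?_
  rw [one_lt_div (by positivity)]
  nlinarith [sq_pos_of_pos (sub_pos.2 hlt)]

/-- The **Riemann mapping theorem** for simply connected subdomains of the disc. -/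
theorem exists_conformal_onto_ball {U : Set ℂ} (hU : IsOpen U) (hUc : IsSimplyConnected U)
    (hsub : U ⊆ Metric.ball 0 1) (h0 : (0 : ℂ) ∈ U) :
    ∃ f : ℂ → ℂ, DifferentiableOn ℂ f U ∧ InjOn f U ∧ f '' U = Metric.ball 0 1 ∧ f 0 = 0 ∧
      deriv f 0 ≠ 0 := by
  let S : Set (ℂ → ℂ) :=
    {f | DifferentiableOn ℂ f U ∧ MapsTo f U (Metric.ball 0 1) ∧ InjOn f U ∧ f 0 = 0}
  let D : Set ℝ := (fun f => ‖deriv f 0‖) '' S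
  have hone : (1 : ℝ) ∈ D := ⟨id, ⟨differentiableOn_id, hsub, injOn_id U, rfl⟩, by simp⟩
  have hbdd : BddAbove D := by
    obtain ⟨r, hr, hball⟩ := Metric.isOpen_iff.1 hU 0 h0
    refine ⟨1 / r, ?_⟩
    rintro _ ⟨f, ⟨hf, hmaps, -, hf0⟩, rfl⟩
    refine norm_deriv_le_div_of_mapsTo_ball (hf.mono hball) ?_ hr
    rw [hf0]
    exact (hmaps.mono_left hball).mono_right Metric.ball_subset_closedBall
  obtain ⟨u, -, hu, huD⟩ := exists_seq_tendsto_sSup ⟨1, hone⟩ hbdd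
  choose F hFS hFu using huD
  obtain ⟨f, hfm, hlim⟩ := exists_tendstoLocallyUniformlyOn_of_mapsTo_ball (hyperfilter ℕ) hU
    (fun n => (hFS n).1) (fun n => (hFS n).2.1)
  have hfd : DifferentiableOn ℂ f U := hlim.differentiableOn (.of_forall fun n => (hFS n).1) hU
  have hnorm : ‖deriv f 0‖ = sSup D := by
    refine tendsto_nhds_unique
      ((hlim.deriv (.of_forall fun n => (hFS n).1) hU).tendsto_at h0).norm ?_
    simpa only [Function.comp_apply, hFu] using hu.mono_left Nat.hyperfilter_le_atTop
  have hd : deriv f 0 ≠ 0 :=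
    norm_pos_iff.1 (hnorm ▸ one_pos.trans_le (le_csSup hbdd hone))
  have hf0 : f 0 = 0 := by
    refine tendsto_nhds_unique (hlim.tendsto_at h0) ?_
    simp only [fun n => (hFS n).2.2.2, tendsto_const_nhds]
  have hinj : InjOn f U := by
    refine injOn_of_tendstoLocallyUniformlyOn hU
      hUc.isPathConnected.isConnected.isPreconnected
      (fun n => (hFS n).1) (fun n => (hFS n).2.2.1) hlim fun c hc => hd ?_
    rw [(hc.eventuallyEq_of_mem (hU.mem_nhds h0)).deriv_eq, deriv_const]
  have hmaps : MapsTo f U (Metric.ball 0 1) := by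
    intro z hz
    rw [← interior_closedBall (0 : ℂ) one_ne_zero, mem_interior_iff_mem_nhds]
    exact mem_of_superset
      (nhds_le_map_nhds_of_injOn hU hfd hinj hz (image_mem_map (hU.mem_nhds hz)))
      hfm.image_subset
  refine ⟨f, hfd, hinj, hmaps.image_subset.antisymm fun w hw => ?_, hf0, hd⟩
  by_contra hwf
  obtain ⟨G, hGd, hGm, hGi, hG0, hlt⟩ :=
    exists_norm_deriv_lt hU hUc h0 hfd hmaps hinj hf0 hd (mem_ball_zero_iff.1 hw) hwf
  exact (hnorm ▸ hlt).not_ge (le_csSup hbdd ⟨G, ⟨hGd, hGm, hGi, hG0⟩, rfl⟩)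

/-! ### Radial hulls -/

theorem IsRadialHull.isOpen {K : Set ℂ} (hK : IsRadialHull K) : IsOpen (UD \ K) :=
  Metric.isOpen_ball.sdiff hK.compact.isClosed

theorem IsRadialHull.zero_mem {K : Set ℂ} (hK : IsRadialHull K) : (0 : ℂ) ∈ UD \ K :=
  ⟨Metric.mem_ball_self one_pos, hK.zero_not_mem⟩

theorem IsRadialHull.exists_normalizedMap {K : Set ℂ} (hK : IsRadialHull K) :
    ∃ g, IsRadialNormalizedMap K g := by
  obtain ⟨f, hf, hinj, honto, hf0, hd⟩ :=
    exists_conformal_onto_ball hK.isOpen hK.simplyConnected sdiff_subset hK.zero_mem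
  have hr : (‖deriv f 0‖ : ℂ) ≠ 0 := ofReal_ne_zero.2 (norm_ne_zero_iff.2 hd)
  set c : ℂ := conj (deriv f 0) / ‖deriv f 0‖
  have hc : ‖c‖ = 1 := by simp [c, hd]
  have hc0 : c ≠ 0 := norm_ne_zero_iff.1 (hc ▸ one_ne_zero)
  have hderiv : deriv (fun z => c * f z) 0 = ‖deriv f 0‖ := by
    rw [deriv_const_mul _ (hf.differentiableAt (hK.isOpen.mem_nhds hK.zero_mem)),
      div_mul_eq_mul_div, conj_mul', div_eq_iff hr, sq]
  refine ⟨fun z => c * f z, hf.const_mul c, (mul_right_injective₀ hc0).comp_injOn hinj, ?_,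
    by simp [hf0], by simp [hderiv], by simpa [hderiv] using hd⟩
  rw [← image_image (c * ·), honto, UD]
  refine Subset.antisymm ?_ fun w hw => ⟨c⁻¹ * w, ?_, mul_inv_cancel_left₀ hc0 w⟩
  · rintro _ ⟨w, hw, rfl⟩
    simpa [hc] using hw
  · simpa [hc] using hw

namespace IsRadialNormalizedMap

variable {K : Set ℂ} {g : ℂ → ℂ}

theorem mapsTo (hg : IsRadialNormalizedMap K g) : MapsTo g (UD \ K) (Metric.ball 0 1) :=
  fun _ hz => hg.onto.subset (mem_image_of_mem g hz)

theorem deriv_eq (hg : IsRadialNormalizedMap K g) : deriv g 0 = ((deriv g 0).re : ℂ) :=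
  Complex.ext rfl (by simpa using hg.deriv0_real)

theorem norm_deriv (hg : IsRadialNormalizedMap K g) : ‖deriv g 0‖ = (deriv g 0).re := by
  rw [hg.deriv_eq, norm_real, ofReal_re, Real.norm_of_nonneg hg.deriv0_pos.le]

theorem norm_deriv_le (hK : IsRadialHull K) (hg : IsRadialNormalizedMap K g) {f : ℂ → ℂ}
    (hf : DifferentiableOn ℂ f (UD \ K)) (hmaps : MapsTo f (UD \ K) (Metric.ball 0 1))
    (hf0 : f 0 = 0) : ‖deriv f 0‖ ≤ (deriv g 0).re :=
  hg.norm_deriv ▸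
    norm_deriv_le_norm_deriv hK.isOpen hK.zero_mem hg.holo hg.inj hg.onto hg.zero hf hmaps hf0

theorem eqOn (hK : IsRadialHull K) (hg : IsRadialNormalizedMap K g) {f : ℂ → ℂ}
    (hf : IsRadialNormalizedMap K f) : EqOn f g (UD \ K) := by
  have hre : (deriv f 0).re = (deriv g 0).re :=
    (hf.norm_deriv ▸ hg.norm_deriv_le hK hf.holo hf.mapsTo hf.zero).antisymm
      (hg.norm_deriv ▸ hf.norm_deriv_le hK hg.holo hg.mapsTo hg.zero)
  refine eqOn_of_deriv_eq hK.isOpen hK.zero_mem hg.holo hg.inj hg.onto hg.zero hf.holo hf.mapsTo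
    hf.zero ?_ fun h => hg.deriv0_pos.ne' (by rw [h, zero_re])
  rw [hf.deriv_eq, hg.deriv_eq, hre]

end IsRadialNormalizedMap

/-- radial capacity is nonnegative and monotone. For a compact
`K ⊆ closure 𝕌` with `0 ∈ 𝕌 \ K` and `𝕌 \ K` simply connected, let `g_K` be the
unique conformal map from `𝕌 \ K` onto `𝕌` with `g_K(0) = 0`, `g_K'(0) > 0`. Then
`a(K) = log g_K'(0) ≥ 0`, and if `K ⊆ K'` then `a(K) ≤ a(K')`. -/
theorem radial_capacity_nonneg_monotone (K : Set ℂ) (hK : IsRadialHull K) :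
    (∃ g, IsRadialNormalizedMap K g)
    ∧ (∀ g g', IsRadialNormalizedMap K g → IsRadialNormalizedMap K g' →
        Set.EqOn g g' (UD \ K))
    ∧ (∀ g, IsRadialNormalizedMap K g → 0 ≤ Real.log ((deriv g 0).re))
    ∧ (∀ K', IsRadialHull K' → K ⊆ K' →
        ∀ g g', IsRadialNormalizedMap K g → IsRadialNormalizedMap K' g' →
          Real.log ((deriv g 0).re) ≤ Real.log ((deriv g' 0).re)) := by
  refine ⟨hK.exists_normalizedMap, fun g g' hg hg' => hg'.eqOn hK hg, fun g hg => ?_,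
    fun K' hK' hsub g g' hg hg' => Real.log_le_log hg.deriv0_pos ?_⟩
  · refine Real.log_nonneg ?_
    simpa using hg.norm_deriv_le hK differentiableOn_id (fun z hz => hz.1) rfl
  · have hdiff : UD \ K' ⊆ UD \ K := sdiff_subset_sdiff_right hsub
    rw [← hg.norm_deriv]
    exact hg'.norm_deriv_le hK' (hg.holo.mono hdiff) (hg.mapsTo.mono_left hdiff) hg.zero

end
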